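/- arXiv:math/9807020 — 4 statements merged into one kernel-verified Lean document; each statement's English description precedes it below -/
import Mathlib

section
/- Let Γ be a countable subgroup of SL(2,ℝ) containing -1 (the negative of the identity matrix). Then the involution σ_ℍ : z ↦ -z̄ of the upper half-plane preserves the Γ-orbit equivalence relation (for all z₁, z₂ ∈ ℍ in the same Γ-orbit, σ_ℍ(z₁) and σ_ℍ(z₂) are in the same Γ-orbit) if and only if S(Γ) = Γ. -/
open Matrix UpperHalfPlane

/-- The map `S` on `SL(2, ℝ)` sending `!![a, b; c, d]` to `!![a, -b; -c, d]`. -/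
noncomputable def S (A : Matrix.SpecialLinearGroup (Fin 2) ℝ) :
    Matrix.SpecialLinearGroup (Fin 2) ℝ :=
  ⟨!![A.1 0 0, -(A.1 0 1); -(A.1 1 0), A.1 1 1], by
    have h := A.2
    rw [Matrix.det_fin_two] at h
    rw [Matrix.det_fin_two_of]
    ring_nf
    linarith⟩

/-- The antiholomorphic involution `σ_ℍ : z ↦ -z̄` of the upper half-plane. -/
def sigmaH (z : UpperHalfPlane) : UpperHalfPlane :=
  ⟨-(starRingEnd ℂ) (z : ℂ), by simpa using z.2⟩

lemma S_S (A : Matrix.SpecialLinearGroup (Fin 2) ℝ) : S (S A) = A := by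
  ext i j
  fin_cases i <;> fin_cases j <;> simp [S]

lemma sigmaH_sigmaH (z : UpperHalfPlane) : sigmaH (sigmaH z) = z := by
  ext
  simp [sigmaH]

lemma sigmaH_smul (A : Matrix.SpecialLinearGroup (Fin 2) ℝ) (z : UpperHalfPlane) :
    sigmaH (A • z) = S A • sigmaH z := by
  ext
  rw [UpperHalfPlane.coe_specialLinearGroup_apply]
  simp only [sigmaH, UpperHalfPlane.coe_specialLinearGroup_apply, S, Algebra.algebraMap_self,
    RingHom.id_apply, map_div₀, map_add, map_mul, Complex.conj_ofReal]
  rw [← neg_div]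
  congr 1
  · simp
    ring
  · simp

/-- The point `iy` of the upper half-plane. -/
noncomputable def imagAxisPoint (y : Set.Ioi (0 : ℝ)) : UpperHalfPlane :=
  ⟨⟨0, y⟩, y.2⟩

lemma entries_of_smul_imagAxisPoint_eq {A : Matrix.SpecialLinearGroup (Fin 2) ℝ}
    {y : Set.Ioi (0 : ℝ)} (h : A • imagAxisPoint y = imagAxisPoint y) :
    A.1 0 0 = A.1 1 1 ∧ A.1 0 1 = -(A.1 1 0 * (y : ℝ) ^ 2) := by
  have hy : (y : ℝ) ≠ 0 := (Set.mem_Ioi.mp y.2).ne'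
  have hz := congrArg (fun z : UpperHalfPlane => (z : ℂ)) h
  have hden : ((A.1 1 0 : ℝ) : ℂ) * (imagAxisPoint y : ℂ) + ((A.1 1 1 : ℝ) : ℂ) ≠ 0 :=
    UpperHalfPlane.denom_ne_zero A (imagAxisPoint y)
  simp only [UpperHalfPlane.specialLinearGroup_apply, Algebra.algebraMap_self,
    RingHom.id_apply] at hz
  have heq := (div_eq_iff hden).mp hz
  have hre := congrArg Complex.re heq
  have him := congrArg Complex.im heq
  simp [imagAxisPoint] at hre him
  constructor
  · apply mul_right_cancel₀ hy
    linarith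
  · linarith

/-- An element of `SL(2, ℝ)` fixing two distinct points of the imaginary axis is `±1`. -/
lemma eq_one_or_eq_neg_one_of_smul_imagAxisPoint_eq {A : Matrix.SpecialLinearGroup (Fin 2) ℝ}
    {y y' : Set.Ioi (0 : ℝ)} (hne : y ≠ y') (h : A • imagAxisPoint y = imagAxisPoint y)
    (h' : A • imagAxisPoint y' = imagAxisPoint y') : A = 1 ∨ A = -1 := by
  obtain ⟨had, hb⟩ := entries_of_smul_imagAxisPoint_eq h
  obtain ⟨-, hb'⟩ := entries_of_smul_imagAxisPoint_eq h'
  have hsq : (y : ℝ) ^ 2 - (y' : ℝ) ^ 2 ≠ 0 := fun hs => hne <| Subtype.ext <|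
    (sq_eq_sq₀ (Set.mem_Ioi.mp y.2).le (Set.mem_Ioi.mp y'.2).le).mp (sub_eq_zero.mp hs)
  have hc : A.1 1 0 = 0 := by
    apply mul_right_cancel₀ hsq
    linarith
  have hb0 : A.1 0 1 = 0 := by simpa [hc] using hb
  have hdet := A.2
  rw [Matrix.det_fin_two, hc, hb0, ← had, mul_zero, sub_zero] at hdet
  refine (mul_self_eq_one_iff.mp hdet).imp (fun ha => ?_) (fun ha => ?_) <;>
  · have hd := had.symm.trans ha
    ext i j
    fin_cases i <;> fin_cases j <;> simp [ha, hd, hc, hb0]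

/-- If every point of the imaginary axis is sent by `A` into its orbit under a countable
subgroup containing `-1`, then `A` lies in that subgroup. -/
lemma mem_of_forall_smul_imagAxisPoint {Γ : Subgroup (Matrix.SpecialLinearGroup (Fin 2) ℝ)}
    (hcount : Set.Countable (Γ : Set (Matrix.SpecialLinearGroup (Fin 2) ℝ)))
    (hneg : (-1 : Matrix.SpecialLinearGroup (Fin 2) ℝ) ∈ Γ)
    {A : Matrix.SpecialLinearGroup (Fin 2) ℝ}
    (h : ∀ y, ∃ B ∈ Γ, A • imagAxisPoint y = B • imagAxisPoint y) : A ∈ Γ := by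
  choose f hfΓ hf using h
  have hninj : ¬ Function.Injective f := fun hinj => by
    have hc : (Set.univ : Set (Set.Ioi (0 : ℝ))).Countable :=
      Set.MapsTo.countable_of_injOn (fun y _ => hfΓ y) hinj.injOn hcount
    have hle := Cardinal.mk_le_aleph0_iff.mpr (Set.countable_univ_iff.mp hc)
    rw [Cardinal.mk_Ioi_real] at hle
    exact Cardinal.aleph0_lt_continuum.not_ge hle
  simp only [Function.Injective, not_forall] at hninj
  obtain ⟨y, y', hyy', hne⟩ := hninj
  have hy : ((f y)⁻¹ * A) • imagAxisPoint y = imagAxisPoint y := by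
    rw [mul_smul, hf, inv_smul_smul]
  have hy' : ((f y)⁻¹ * A) • imagAxisPoint y' = imagAxisPoint y' := by
    rw [mul_smul, hf, hyy', inv_smul_smul]
  rw [← Γ.mul_mem_cancel_left (Γ.inv_mem (hfΓ y))]
  rcases eq_one_or_eq_neg_one_of_smul_imagAxisPoint_eq hne hy hy' with h1 | h1
  · exact h1 ▸ Γ.one_mem
  · exact h1 ▸ hneg

theorem stmt3 (Γ : Subgroup (Matrix.SpecialLinearGroup (Fin 2) ℝ))
    (hcount : Set.Countable (Γ : Set (Matrix.SpecialLinearGroup (Fin 2) ℝ)))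
    (hneg : (-1 : Matrix.SpecialLinearGroup (Fin 2) ℝ) ∈ Γ) :
    (∀ z₁ z₂ : UpperHalfPlane, (∃ A ∈ Γ, z₂ = A • z₁) →
      ∃ B ∈ Γ, sigmaH z₂ = B • sigmaH z₁) ↔
    S '' (Γ : Set (Matrix.SpecialLinearGroup (Fin 2) ℝ)) = Γ := by
  constructor
  · intro h
    have hS : ∀ A ∈ Γ, S A ∈ Γ := fun A hA =>
      mem_of_forall_smul_imagAxisPoint hcount hneg fun y => by
        obtain ⟨B, hB, hBz⟩ := h (sigmaH (imagAxisPoint y)) _ ⟨A, hA, rfl⟩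
        rw [sigmaH_smul, sigmaH_sigmaH] at hBz
        exact ⟨B, hB, hBz⟩
    exact Set.Subset.antisymm (Set.image_subset_iff.mpr hS)
      fun A hA => ⟨S A, hS A hA, S_S A⟩
  · rintro h z _ ⟨A, hA, rfl⟩
    exact ⟨S A, h.subset ⟨A, hA, rfl⟩, sigmaH_smul A z⟩
end

section
/- Let τ ∈ ℂ with Im(τ) > 0, and let L(τ) = ℤ + ℤτ be the additive subgroup of ℂ generated by 1 and τ. Then complex conjugation maps L(τ) onto itself if and only if 2·Re(τ) is an integer. -/
/-- The lattice `L(τ) = ℤ + ℤτ` in `ℂ`. -/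
def lattice (τ : ℂ) : Set ℂ := {z : ℂ | ∃ a b : ℤ, z = (a : ℂ) + (b : ℂ) * τ}

theorem conj_eq_intCast_sub_of_two_mul_re_eq {τ : ℂ} {n : ℤ} (h : 2 * τ.re = (n : ℝ)) :
    (starRingEnd ℂ) τ = (n : ℂ) - τ := by
  apply Complex.ext
  · simp only [Complex.conj_re, Complex.sub_re, Complex.intCast_re]
    linarith
  · simp

theorem conj_mem_lattice {τ : ℂ} {n : ℤ} (h : 2 * τ.re = (n : ℝ)) {z : ℂ}
    (hz : z ∈ lattice τ) : (starRingEnd ℂ) z ∈ lattice τ := by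
  obtain ⟨a, b, rfl⟩ := hz
  refine ⟨a + b * n, -b, ?_⟩
  simp only [map_add, map_mul, map_intCast, conj_eq_intCast_sub_of_two_mul_re_eq h]
  push_cast
  ring

theorem stmt4 (τ : ℂ) (hτ : 0 < τ.im) :
    (starRingEnd ℂ) '' lattice τ = lattice τ ↔ ∃ n : ℤ, 2 * τ.re = (n : ℝ) := by
  constructor
  · intro h
    have hmem : (starRingEnd ℂ) τ ∈ lattice τ := by
      rw [← h]
      exact Set.mem_image_of_mem _ ⟨0, 1, by simp⟩
    obtain ⟨a, b, hab⟩ := hmem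
    have hre := congrArg Complex.re hab
    have him := congrArg Complex.im hab
    simp at hre him
    have hb : (b : ℝ) = -1 := mul_right_cancel₀ hτ.ne' (by linarith)
    rw [hb] at hre
    exact ⟨a, by linarith⟩
  · rintro ⟨n, hn⟩
    apply Set.Subset.antisymm
    · rintro _ ⟨z, hz, rfl⟩
      exact conj_mem_lattice hn hz
    · intro z hz
      exact ⟨_, conj_mem_lattice hn hz, Complex.conj_conj z⟩
end

section
/- Let λ be a real number with λ ≠ 0 and λ ≠ 1, and consider the Weierstrass curve E_λ over ℝ given by y² = x(x - 1)(x - λ), i.e., with coefficients a₁ = 0, a₂ = -(λ + 1), a₃ = 0, a₄ = λ, a₆ = 0. Then E_λ is an elliptic curve (its discriminant is nonzero) and its j-invariant satisfies j(E_λ) ≥ 1728. -/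
/-- The discriminant of the Legendre curve `y² = x(x - 1)(x - lam)`. -/
theorem WeierstrassCurve.legendre_Δ {R : Type*} [CommRing R] (lam : R) :
    ({ a₁ := 0, a₂ := -(lam + 1), a₃ := 0, a₄ := lam, a₆ := 0 } : WeierstrassCurve R).Δ =
      16 * (lam * (lam - 1)) ^ 2 := by
  simp only [WeierstrassCurve.Δ, WeierstrassCurve.b₂, WeierstrassCurve.b₄, WeierstrassCurve.b₆,
    WeierstrassCurve.b₈]
  ring

/-- A Weierstrass curve with positive discriminant has `j`-invariant at least `1728`. -/
theorem WeierstrassCurve.le_c₄_pow_div_Δ {K : Type*} [Field K] [LinearOrder K]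
    [IsStrictOrderedRing K] (W : WeierstrassCurve K) (h : 0 < W.Δ) :
    1728 ≤ W.c₄ ^ 3 / W.Δ := by
  rw [le_div_iff₀ h, W.c_relation]
  exact sub_le_self _ (sq_nonneg _)

theorem stmt8 (lam : ℝ) (h0 : lam ≠ 0) (h1 : lam ≠ 1) :
    ({ a₁ := 0, a₂ := -(lam + 1), a₃ := 0, a₄ := lam, a₆ := 0 } : WeierstrassCurve ℝ).Δ ≠ 0 ∧
    1728 ≤ ({ a₁ := 0, a₂ := -(lam + 1), a₃ := 0, a₄ := lam, a₆ := 0 } : WeierstrassCurve ℝ).c₄ ^ 3 /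
      ({ a₁ := 0, a₂ := -(lam + 1), a₃ := 0, a₄ := lam, a₆ := 0 } : WeierstrassCurve ℝ).Δ := by
  have hΔ : 0 < ({ a₁ := 0, a₂ := -(lam + 1), a₃ := 0, a₄ := lam, a₆ := 0 } :
      WeierstrassCurve ℝ).Δ := by
    rw [WeierstrassCurve.legendre_Δ]
    have := sub_ne_zero.mpr h1
    positivity
  exact ⟨hΔ.ne', WeierstrassCurve.le_c₄_pow_div_Δ _ hΔ⟩
end

section
/- Let b, c be real numbers with b² < 4c, and consider the Weierstrass curve E over ℝ given by y² = x(x² + bx + c), i.e., with coefficients a₁ = 0, a₂ = b, a₃ = 0, a₄ = c, a₆ = 0. Then E is an elliptic curve (its discriminant is nonzero) and its j-invariant satisfies j(E) ≤ 1728. -/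
theorem stmt9 (b c : ℝ) (hbc : b ^ 2 < 4 * c) :
    ({ a₁ := 0, a₂ := b, a₃ := 0, a₄ := c, a₆ := 0 } : WeierstrassCurve ℝ).Δ ≠ 0 ∧
    ({ a₁ := 0, a₂ := b, a₃ := 0, a₄ := c, a₆ := 0 } : WeierstrassCurve ℝ).c₄ ^ 3 /
      ({ a₁ := 0, a₂ := b, a₃ := 0, a₄ := c, a₆ := 0 } : WeierstrassCurve ℝ).Δ ≤ 1728 := by
  set W : WeierstrassCurve ℝ := { a₁ := 0, a₂ := b, a₃ := 0, a₄ := c, a₆ := 0 } with hW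
  have hc : 0 < c := by nlinarith [sq_nonneg b]
  have hΔ : W.Δ = 16 * c ^ 2 * (b ^ 2 - 4 * c) := by
    simp only [hW, WeierstrassCurve.Δ, WeierstrassCurve.b₂, WeierstrassCurve.b₄,
      WeierstrassCurve.b₆, WeierstrassCurve.b₈]
    ring
  have hneg : W.Δ < 0 := by
    rw [hΔ]
    exact mul_neg_of_pos_of_neg (by positivity) (by linarith)
  refine ⟨hneg.ne, ?_⟩
  rw [div_le_iff_of_neg hneg]
  linarith [W.c_relation, sq_nonneg W.c₆]
end
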